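/- arXiv:2305.06498 — 4 statements merged into one kernel-verified Lean document; each statement's English description precedes it below -/
import Mathlib

section
/- Let m be a positive integer and let γ be any element of SL_m(ℝ). Then there exists a subgroup H of SL_m(ℝ) of countable index in SL_m(ℝ) which intersects the cyclic subgroup generated by γ trivially, i.e. H ∩ ⟨γ⟩ = {1}. -/
open Polynomial in
/-- An algebraically closed algebraic extension of a separable valued field is separable
(continuity of roots). -/
theorem separableSpace_of_isAlgebraic {K L : Type*} [NormedField K] [NormedField L]
    [Algebra K L] [Algebra.IsAlgebraic K L] [IsAlgClosed L]
    [TopologicalSpace.SeparableSpace K] (hnorm : ∀ k : K, ‖algebraMap K L k‖ = ‖k‖) :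
    TopologicalSpace.SeparableSpace L := by
  obtain ⟨D, hDc, hD⟩ := TopologicalSpace.exists_countable_dense K
  have : Countable D := hDc
  let g : (Σ d : ℕ, Fin d → D) → L[X] := fun p ↦
    X ^ p.1 + ∑ i : Fin p.1, C (algebraMap K L (p.2 i)) * X ^ (i : ℕ)
  have hlt (p : Σ d : ℕ, Fin d → D) :
      degree (∑ i : Fin p.1, C (algebraMap K L (p.2 i)) * X ^ (i : ℕ)) < p.1 :=
    degree_sum_fin_lt fun i ↦ algebraMap K L (p.2 i)
  have hmonic (p) : (g p).Monic := monic_X_pow_add (hlt p)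
  have hdeg (p) : (g p).natDegree = p.1 := by
    rw [natDegree_add_eq_left_of_degree_lt (by simpa using hlt p), natDegree_X_pow]
  refine ⟨⋃ p, {β | β ∈ (g p).roots},
    Set.countable_iUnion fun p ↦ ((g p).roots.finite_toSet).countable, ?_⟩
  rw [Metric.dense_iff]
  intro x ε hε
  set f := minpoly K x
  set d := f.natDegree with hd
  have hf : f.Monic := minpoly.monic (Algebra.IsIntegral.isIntegral x)
  have hfx : x ^ d + ∑ i : Fin d, algebraMap K L (f.coeff i) * x ^ (i : ℕ) = 0 := by
    have h : aeval x f = 0 := minpoly.aeval K x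
    rw [hf.as_sum] at h
    simpa [Finset.sum_range] using h
  set T := ∑ i : Fin d, ‖x‖ ^ (i : ℕ)
  have hT : 0 ≤ T := by positivity
  have hδ : 0 < ε ^ d / (1 + T) := by positivity
  have hex (i : Fin d) : ∃ c : D, ‖(c : K) - f.coeff i‖ < ε ^ d / (1 + T) := by
    obtain ⟨c, hcD, hc⟩ := hD.exists_dist_lt (f.coeff i) hδ
    exact ⟨⟨c, hcD⟩, by rwa [← dist_eq_norm, dist_comm]⟩
  choose c hc using hex
  let p : Σ d : ℕ, Fin d → D := ⟨d, c⟩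
  have heval : (g p).eval x =
      ∑ i : Fin d, algebraMap K L ((c i : K) - f.coeff i) * x ^ (i : ℕ) := by
    rw [← sub_zero ((g p).eval x), ← hfx]
    simp [g, p, eval_finsetSum, sub_mul, Finset.sum_sub_distrib]
  have hsmall : ‖(g p).eval x‖ < ε ^ d := by
    calc ‖(g p).eval x‖ ≤ ∑ i : Fin d, ε ^ d / (1 + T) * ‖x‖ ^ (i : ℕ) := by
          rw [heval]
          refine norm_sum_le_of_le _ fun i _ ↦ ?_
          rw [norm_mul, hnorm, norm_pow]
          gcongr
          exact (hc i).le
      _ = ε ^ d * (T / (1 + T)) := by rw [← Finset.mul_sum]; ring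
      _ < ε ^ d * 1 := by
          gcongr
          rw [div_lt_one (by positivity)]
          linarith
      _ = ε ^ d := mul_one _
  by_contra hne
  have hfar : ∀ β ∈ (g p).roots, ε ≤ ‖x - β‖ := by
    intro β hβ
    by_contra! hlt
    exact hne ⟨β, by rwa [Metric.mem_ball, dist_comm, dist_eq_norm], Set.mem_iUnion.2 ⟨p, hβ⟩⟩
  have hsplit := IsAlgClosed.splits (g p)
  have hprod : ‖(g p).eval x‖ = ((g p).roots.map fun β ↦ ‖x - β‖).prod := by
    rw [hsplit.eval_eq_prod_roots_of_monic (hmonic p), ← normHom_apply, map_multiset_prod,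
      Multiset.map_map]
    rfl
  have hcard : (g p).roots.card = d := by rw [← hsplit.natDegree_eq_card_roots, hdeg]
  refine hsmall.not_ge ?_
  rw [hprod, ← hcard, ← Multiset.prod_replicate, ← Multiset.map_const']
  exact Multiset.prod_map_le_prod_map₀ _ _ (fun _ _ ↦ hε.le) hfar

/-- The units of an ultrametric normed ring at distance less than `r` from `1`. -/
def congruenceUnits (A : Type*) [NormedRing A] [IsUltrametricDist A] (h1 : ‖(1 : A)‖ ≤ 1)
    (r : ℝ) (hr0 : 0 < r) (hr1 : r ≤ 1) : Subgroup Aˣ where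
  carrier := {u | ‖(u : A) - 1‖ < r}
  one_mem' := by simpa using hr0
  mul_mem' := by
    intro u v hu hv
    simp only [Set.mem_ofPred_eq, Units.val_mul] at *
    have h : (u * v : A) - 1 = (u - 1) * (v - 1) + ((u - 1) + (v - 1)) := by noncomm_ring
    rw [h]
    have h2 : ‖((u : A) - 1) * (v - 1)‖ < r :=
      (norm_mul_le _ _).trans_lt (by nlinarith [norm_nonneg ((u : A) - 1), norm_nonneg ((v : A) - 1)])
    exact (IsUltrametricDist.norm_add_le_max _ _).trans_lt
      (max_lt h2 ((IsUltrametricDist.norm_add_le_max _ _).trans_lt (max_lt hu hv)))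
  inv_mem' := by
    intro u hu
    simp only [Set.mem_ofPred_eq] at *
    have h : ((u⁻¹ : Aˣ) : A) - 1 = -((u - 1) * ((u⁻¹ : Aˣ) : A)) := by simp [sub_mul]
    have hs : ‖((u⁻¹ : Aˣ) : A) - 1‖ ≤ ‖(u : A) - 1‖ * max ‖((u⁻¹ : Aˣ) : A) - 1‖ 1 := by
      calc _ ≤ ‖(u : A) - 1‖ * ‖((u⁻¹ : Aˣ) : A)‖ := by
            conv_lhs => rw [h, norm_neg]
            exact norm_mul_le _ _
        _ ≤ _ := by
            gcongr
            calc ‖((u⁻¹ : Aˣ) : A)‖ = ‖(((u⁻¹ : Aˣ) : A) - 1) + 1‖ := by rw [sub_add_cancel]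
              _ ≤ _ := (IsUltrametricDist.norm_add_le_max _ _).trans (max_le_max le_rfl h1)
    rcases le_total ‖((u⁻¹ : Aˣ) : A) - 1‖ 1 with h' | h'
    · rw [max_eq_right h'] at hs
      linarith
    · rw [max_eq_left h'] at hs
      nlinarith

section

variable {A : Type*} [NormedRing A] [IsUltrametricDist A] (h1 : ‖(1 : A)‖ ≤ 1)

theorem mem_congruenceUnits {r : ℝ} {hr0 : 0 < r} {hr1 : r ≤ 1} {u : Aˣ} :
    u ∈ congruenceUnits A h1 r hr0 hr1 ↔ ‖(u : A) - 1‖ < r := Iff.rfl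

theorem countable_quotient_congruenceUnits [SecondCountableTopology A]
    {r : ℝ} (hr0 : 0 < r) (hr1 : r ≤ 1) :
    Countable (Aˣ ⧸ congruenceUnits A h1 r hr0 hr1) := by
  have hopen : IsOpen (congruenceUnits A h1 r hr0 hr1 : Set Aˣ) := by
    have : Continuous fun u : Aˣ ↦ ‖(u : A) - 1‖ := by fun_prop
    exact isOpen_lt this continuous_const
  have := QuotientGroup.discreteTopology hopen
  have : SecondCountableTopology Aᵐᵒᵖ :=
    MulOpposite.opHomeomorph.symm.isEmbedding.secondCountableTopology
  have : SecondCountableTopology Aˣ := Units.isEmbedding_embedProduct.secondCountableTopology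
  have : TopologicalSpace.SeparableSpace (Aˣ ⧸ congruenceUnits A h1 r hr0 hr1) :=
    QuotientGroup.mk_surjective.denseRange.separableSpace QuotientGroup.continuous_mk
  exact TopologicalSpace.separableSpace_iff_countable.1 this

/-- If nonzero integers have norm one, then taking powers does not change the distance to `1`
of an element of the open unit ball around `1`. -/
theorem norm_pow_sub_one_eq (hnat : ∀ n : ℕ, n ≠ 0 → ∀ a : A, ‖n • a‖ = ‖a‖)
    {a : A} (ha0 : a ≠ 1) (ha : ‖a - 1‖ < 1) {n : ℕ} (hn : n ≠ 0) :
    ‖a ^ n - 1‖ = ‖a - 1‖ := by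
  have hpos : 0 < ‖a - 1‖ := norm_pos_iff.2 (sub_ne_zero.2 ha0)
  have key : ∀ k : ℕ, ‖a ^ k - 1 - k • (a - 1)‖ ≤ ‖a - 1‖ ^ 2 := by
    intro k
    induction k with
    | zero => simp
    | succ k ih =>
      have h : a ^ (k + 1) - 1 - (k + 1) • (a - 1) =
          (a ^ k - 1 - k • (a - 1)) + (a ^ k - 1) * (a - 1) := by
        rw [pow_succ, add_smul, one_smul]
        noncomm_ring
      have hk : ‖a ^ k - 1‖ ≤ ‖a - 1‖ := by
        have h2 : ‖k • (a - 1)‖ ≤ ‖a - 1‖ := by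
          rcases eq_or_ne k 0 with rfl | hk
          · simp
          · exact (hnat k hk _).le
        rw [← sub_add_cancel (a ^ k - 1) (k • (a - 1))]
        exact (IsUltrametricDist.norm_add_le_max _ _).trans
          (max_le (ih.trans (by nlinarith)) h2)
      rw [h]
      refine (IsUltrametricDist.norm_add_le_max _ _).trans (max_le ih ?_)
      refine (norm_mul_le _ _).trans ?_
      rw [sq]
      gcongr
  have hlt : ‖a ^ n - 1 - n • (a - 1)‖ < ‖n • (a - 1)‖ := by
    rw [hnat n hn]
    exact (key n).trans_lt (by nlinarith)
  rw [← hnat n hn (a - 1), ← sub_add_cancel (a ^ n - 1) (n • (a - 1)),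
    IsUltrametricDist.norm_add_eq_max_of_norm_ne_norm hlt.ne, max_eq_right hlt.le]

/-- In a separable ultrametric normed ring in which nonzero integers have norm one, every cyclic
group of units meets trivially some countable-index subgroup of the group of units. -/
theorem exists_countable_index_subgroup_units [SecondCountableTopology A] (h1 : ‖(1 : A)‖ ≤ 1)
    (hnat : ∀ n : ℕ, n ≠ 0 → ∀ a : A, ‖n • a‖ = ‖a‖) (γ : Aˣ) :
    ∃ H : Subgroup Aˣ, Countable (Aˣ ⧸ H) ∧ H ⊓ Subgroup.zpowers γ = ⊥ := by
  by_cases hγ : congruenceUnits A h1 1 one_pos le_rfl ⊓ Subgroup.zpowers γ = ⊥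
  · exact ⟨_, countable_quotient_congruenceUnits h1 _ _, hγ⟩
  rw [← ne_eq, Subgroup.ne_bot_iff_exists_ne_one] at hγ
  obtain ⟨⟨δ, hδ, hδγ⟩, hδ1⟩ := hγ
  replace hδ1 : δ ≠ 1 := fun h ↦ hδ1 (Subtype.ext h)
  replace hδ1 : (δ : A) ≠ 1 := by simpa using hδ1
  replace hδ : ‖(δ : A) - 1‖ < 1 := hδ
  obtain ⟨n, rfl⟩ := Subgroup.mem_zpowers_iff.1 hδγ
  have hpos : 0 < ‖((γ ^ n : Aˣ) : A) - 1‖ := norm_pos_iff.2 (sub_ne_zero.2 hδ1)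
  refine ⟨congruenceUnits A h1 _ hpos hδ.le, countable_quotient_congruenceUnits h1 _ _, ?_⟩
  rw [Subgroup.eq_bot_iff_forall]
  rintro _ ⟨hx, k, rfl⟩
  obtain ⟨j, rfl | rfl⟩ : ∃ j : ℕ, k = j ∨ k = -j := ⟨k.natAbs, by omega⟩
  all_goals
    by_contra hne
    have hj : j ≠ 0 := by
      rintro rfl
      simp at hne
    have hmem : γ ^ (j : ℤ) ∈ congruenceUnits A h1 _ hpos hδ.le := by
      simpa using hx
    have hpow := (mem_congruenceUnits h1).1 (zpow_mem hmem n)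
    rw [← zpow_mul, mul_comm, zpow_mul, zpow_natCast, Units.val_pow_eq_pow_val,
      norm_pow_sub_one_eq hnat hδ1 hδ hj] at hpow
    exact hpow.false

end

theorem countable_quotient_comap {G G' : Type*} [Group G] [Group G'] (f : G →* G')
    (H : Subgroup G') [Countable (G' ⧸ H)] : Countable (G ⧸ H.comap f) := by
  let F : G ⧸ H.comap f → G' ⧸ H := Quotient.map' f fun a b h ↦ by
    simpa [QuotientGroup.leftRel_apply] using h
  refine Function.Injective.countable (f := F) ?_
  rintro ⟨a⟩ ⟨b⟩ h
  refine QuotientGroup.eq.2 ?_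
  simpa using QuotientGroup.eq.1 h

section

attribute [local instance] Matrix.normedAddCommGroup

theorem Matrix.norm_mul_le_of_isUltrametricDist {n L : Type*} [Fintype n]
    [NormedField L] [IsUltrametricDist L] (a b : Matrix n n L) : ‖a * b‖ ≤ ‖a‖ * ‖b‖ := by
  refine (Matrix.norm_le_iff (by positivity)).2 fun i j ↦ ?_
  rw [Matrix.mul_apply]
  refine IsUltrametricDist.norm_sum_le_of_forall_le_of_nonneg (by positivity) fun k _ ↦ ?_
  rw [norm_mul]
  gcongr
  · exact Matrix.norm_entry_le_entrywise_sup_norm a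
  · exact Matrix.norm_entry_le_entrywise_sup_norm b

/-- Square matrices over an ultrametric normed field, with the supremum norm of the entries, form
a normed ring. -/
noncomputable abbrev Matrix.ultrametricNormedRing (n L : Type*) [Fintype n] [DecidableEq n]
    [NormedField L] [IsUltrametricDist L] : NormedRing (Matrix n n L) :=
  { Matrix.normedAddCommGroup, Matrix.instRing with
    dist_eq := fun a b ↦ Matrix.normedAddCommGroup.dist_eq a b
    norm_mul_le := Matrix.norm_mul_le_of_isUltrametricDist }

/-- Every cyclic subgroup of `GL n L`, with `L` a separable ultrametric field in which nonzero
integers have norm one, meets trivially some subgroup of countable index. -/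
theorem exists_countable_index_subgroup_GL (n L : Type*) [Fintype n] [DecidableEq n]
    [NormedField L] [IsUltrametricDist L] [SecondCountableTopology L]
    (hnat : ∀ n : ℕ, n ≠ 0 → ‖(n : L)‖ = 1) (γ : Matrix.GeneralLinearGroup n L) :
    ∃ H : Subgroup (Matrix.GeneralLinearGroup n L), Countable (Matrix.GeneralLinearGroup n L ⧸ H) ∧
      H ⊓ Subgroup.zpowers γ = ⊥ := by
  let := Matrix.ultrametricNormedRing n L
  have : IsUltrametricDist (Matrix n n L) :=
    inferInstanceAs (IsUltrametricDist (n → n → L))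
  have h1 : ‖(1 : Matrix n n L)‖ ≤ 1 :=
    (Matrix.norm_le_iff zero_le_one).2 fun i j ↦ by
      rw [Matrix.one_apply]
      split_ifs <;> simp
  refine @exists_countable_index_subgroup_units _ _ _
    (inferInstanceAs (SecondCountableTopology (n → n → L))) h1 (fun k hk a ↦ ?_) γ
  refine le_antisymm ((Matrix.norm_le_iff (norm_nonneg _)).2 fun i j ↦ ?_)
    ((Matrix.norm_le_iff (norm_nonneg _)).2 fun i j ↦ ?_)
  · have h : ‖(k • a) i j‖ = ‖a i j‖ := by simp [hnat k hk]
    exact h.trans_le (Matrix.norm_entry_le_entrywise_sup_norm a)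
  · have h : ‖a i j‖ = ‖(k • a) i j‖ := by simp [hnat k hk]
    exact h.trans_le (Matrix.norm_entry_le_entrywise_sup_norm (k • a))

end

open scoped Cardinal LaurentSeries

theorem countable_ratFunc_rat : Countable (RatFunc ℚ) := by
  have h : #(Polynomial ℚ) ≤ ℵ₀ := by simp
  exact Cardinal.mk_le_aleph0_iff.1
    ((IsLocalization.cardinalMk_le (nonZeroDivisors (Polynomial ℚ))).trans h)

instance charZero_laurentSeries_rat : CharZero ℚ⸨X⸩ :=
  charZero_of_injective_algebraMap (algebraMap ℚ ℚ⸨X⸩).injective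

theorem cardinalMk_laurentSeries_rat : #ℚ⸨X⸩ = 𝔠 := by
  refine le_antisymm ?_ ?_
  · have h := Cardinal.mk_le_of_injective (HahnSeries.coeff_injective (Γ := ℤ) (R := ℚ))
    simpa using h
  · have hi : Function.Injective fun f : ℕ → ℚ ↦ ((PowerSeries.mk f : PowerSeries ℚ) : ℚ⸨X⸩) := by
      intro f g h
      have := HahnSeries.ofPowerSeries_injective h
      ext n
      simpa using congrArg (PowerSeries.coeff n) this
    simpa using Cardinal.mk_le_of_injective hi

theorem nonempty_ringEquiv_complex_algebraicClosure_laurentSeries :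
    Nonempty (ℂ ≃+* AlgebraicClosure ℚ⸨X⸩) := by
  have : CharZero (AlgebraicClosure ℚ⸨X⸩) :=
    charZero_of_injective_algebraMap (algebraMap ℚ⸨X⸩ (AlgebraicClosure ℚ⸨X⸩)).injective
  refine IsAlgClosed.ringEquiv_of_equiv_of_charZero (by simpa using Cardinal.aleph0_lt_continuum) ?_
  refine Cardinal.eq.1 ?_
  rw [Cardinal.mk_complex]
  refine le_antisymm ?_ ?_
  · rw [← cardinalMk_laurentSeries_rat]
    exact Cardinal.mk_le_of_injective (algebraMap ℚ⸨X⸩ (AlgebraicClosure ℚ⸨X⸩)).injective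
  · refine (Algebra.IsAlgebraic.cardinalMk_le_max ℚ⸨X⸩ _).trans ?_
    rw [cardinalMk_laurentSeries_rat]
    exact max_le le_rfl Cardinal.aleph0_le_continuum

theorem valuation_laurentSeries_natCast {n : ℕ} (hn : n ≠ 0) :
    (Valued.v (n : ℚ⸨X⸩) : WithZero (Multiplicative ℤ)) = 1 := by
  have h (q : ℚ) : (Valued.v (algebraMap ℚ ℚ⸨X⸩ q) : WithZero (Multiplicative ℤ)) ≤ 1 :=
    (LaurentSeries.val_le_one_iff_eq_coe ℚ _).2 ⟨PowerSeries.C q, by simp⟩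
  refine le_antisymm (by simpa using h n) ?_
  have h2 := h (n : ℚ)⁻¹
  rw [map_inv₀, map_inv₀, map_natCast] at h2
  have h0 : (Valued.v (n : ℚ⸨X⸩) : WithZero (Multiplicative ℤ)) ≠ 0 := by
    rw [Valuation.ne_zero_iff]; exact_mod_cast hn
  exact (inv_le_one₀ (zero_lt_iff.2 h0)).1 h2

/-- The field of real numbers embeds into a separable ultrametric normed field in which nonzero
integers have norm one. -/
theorem exists_normedField_ringHom_real :
    ∃ (L : Type) (_ : NormedField L) (_ : IsUltrametricDist L) (_ : SecondCountableTopology L)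
      (_ : ℝ →+* L), ∀ n : ℕ, n ≠ 0 → ‖(n : L)‖ = 1 := by
  let v : Valuation ℚ⸨X⸩ (WithZero (Multiplicative ℤ)) := Valued.v
  have hnt : v.IsNontrivial :=
    inferInstanceAs ((PowerSeries.idealX ℚ).valuation ℚ⸨X⸩).IsNontrivial
  obtain ⟨hrk⟩ := (Valuation.nonempty_rankOne_iff_mulArchimedean (v := v)).2 inferInstance
  let : NontriviallyNormedField ℚ⸨X⸩ :=
    Valued.toNontriviallyNormedField (L := ℚ⸨X⸩) (Γ₀ := WithZero (Multiplicative ℤ))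
  have hu : IsUltrametricDist ℚ⸨X⸩ := inferInstance
  have hnat {n : ℕ} (hn : n ≠ 0) : ‖(n : ℚ⸨X⸩)‖ = 1 :=
    le_antisymm
      (Valued.toNormedField.norm_le_one_iff.2 (valuation_laurentSeries_natCast hn).le)
      (Valued.toNormedField.one_le_norm_iff.2 (valuation_laurentSeries_natCast hn).ge)
  have := countable_ratFunc_rat
  have hsep : TopologicalSpace.SeparableSpace ℚ⸨X⸩ :=
    ⟨_, Set.countable_range _, LaurentSeries.coe_range_dense (K := ℚ)⟩
  let L := AlgebraicClosure ℚ⸨X⸩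
  let : NormedField L := spectralNorm.normedField ℚ⸨X⸩ L
  have hext (k : ℚ⸨X⸩) : ‖algebraMap ℚ⸨X⸩ L k‖ = ‖k‖ := spectralNorm_extends k
  have hsepL : TopologicalSpace.SeparableSpace L := separableSpace_of_isAlgebraic hext
  obtain ⟨e⟩ := nonempty_ringEquiv_complex_algebraicClosure_laurentSeries
  refine ⟨L, inferInstance, ?_, UniformSpace.secondCountable_of_separable L,
    e.toRingHom.comp (algebraMap ℝ ℂ), fun n hn ↦ ?_⟩
  · exact IsUltrametricDist.isUltrametricDist_of_forall_norm_add_le_max_norm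
      fun x y ↦ isNonarchimedean_spectralNorm x y
  · rw [← map_natCast (algebraMap ℚ⸨X⸩ L), hext, hnat hn]

/-- For any element `γ` of `SL_m(ℝ)` there is a subgroup of countable index in `SL_m(ℝ)`
meeting the cyclic subgroup generated by `γ` trivially. -/
theorem exists_countable_index_subgroup_avoiding_zpowers_SL_real
    (m : ℕ) (hm : 0 < m) (γ : Matrix.SpecialLinearGroup (Fin m) ℝ) :
    ∃ H : Subgroup (Matrix.SpecialLinearGroup (Fin m) ℝ),
      Countable (Matrix.SpecialLinearGroup (Fin m) ℝ ⧸ H) ∧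
      H ⊓ Subgroup.zpowers γ = ⊥ := by
  obtain ⟨L, _, _, _, φ, hnat⟩ := exists_normedField_ringHom_real
  let f : Matrix.SpecialLinearGroup (Fin m) ℝ →* (Matrix.GeneralLinearGroup (Fin m) L) :=
    Matrix.SpecialLinearGroup.toGL.comp (Matrix.SpecialLinearGroup.map φ)
  have hf : Function.Injective f := by
    intro a b hab
    ext i j
    apply φ.injective
    exact congrArg (fun u : Matrix.GeneralLinearGroup (Fin m) L ↦ u.val i j) hab
  obtain ⟨H, hH, hHγ⟩ := exists_countable_index_subgroup_GL (Fin m) L hnat (f γ)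
  refine ⟨H.comap f, countable_quotient_comap f H, ?_⟩
  rw [Subgroup.eq_bot_iff_forall]
  rintro x ⟨hx, k, rfl⟩
  have hmem : f (γ ^ k) ∈ H ⊓ Subgroup.zpowers (f γ) := ⟨hx, k, (map_zpow f γ k).symm⟩
  rw [hHγ, Subgroup.mem_bot] at hmem
  exact hf (hmem.trans (map_one f).symm)
end

section
/- Let m be a positive integer and let γ be any element of SL_m(ℂ). Then there exists a subgroup H of SL_m(ℂ) of countable index in SL_m(ℂ) which intersects the cyclic subgroup generated by γ trivially, i.e. H ∩ ⟨γ⟩ = {1}. -/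
namespace Valuation

open Matrix

section Matrices

variable {K Γ n : Type*} [Field K] [LinearOrderedCommGroupWithZero Γ] (v : Valuation K Γ)

lemma map_mul_apply_lt [Fintype n] {c : Γ} (hc : c ≠ 0) {A B : Matrix n n K}
    (h : ∀ i j k, v (A i k) * v (B k j) < c) (i j : n) : v ((A * B) i j) < c := by
  rw [Matrix.mul_apply]
  exact v.map_sum_lt hc fun k _ ↦ by simpa using h i j k

lemma map_entry_le_one_of_sub_one_lt [DecidableEq n] {c : Γ} (hc : c ≤ 1) {A : Matrix n n K}
    (hA : ∀ i j, v ((A - 1) i j) < c) (i j : n) : v (A i j) ≤ 1 := by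
  have h : A i j = (A - 1) i j + (1 : Matrix n n K) i j := by simp
  rw [h]
  refine v.map_add_le ((hA i j).le.trans hc) ?_
  rw [Matrix.one_apply]
  split_ifs <;> simp

variable [Fintype n] [DecidableEq n]

lemma map_det_le_one {A : Matrix n n K} (hA : ∀ i j, v (A i j) ≤ 1) : v A.det ≤ 1 := by
  rw [Matrix.det_apply']
  refine v.map_sum_le fun σ _ ↦ ?_
  rw [map_mul, map_prod]
  refine mul_le_one' ?_ (Finset.prod_le_one' fun i _ ↦ hA _ _)
  rcases Int.units_eq_one_or (Equiv.Perm.sign σ) with h | h <;> simp [h]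

lemma map_adjugate_le_one {A : Matrix n n K} (hA : ∀ i j, v (A i j) ≤ 1) (i j : n) :
    v (A.adjugate i j) ≤ 1 := by
  rw [Matrix.adjugate_apply]
  refine v.map_det_le_one fun k l ↦ ?_
  rw [Matrix.updateRow_apply]
  split_ifs
  · rw [Pi.single_apply]
    split_ifs <;> simp
  · exact hA k l

/-- The subgroup of `SL n K` of matrices whose difference to the identity has entries of
valuation less than `c`. -/
def congruenceSubgroup (c : Γ) (hc₀ : c ≠ 0) (hc₁ : c ≤ 1) :
    Subgroup (SpecialLinearGroup n K) where
  carrier := {g | ∀ i j, v (((g : Matrix n n K) - 1) i j) < c}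
  one_mem' i j := by simpa using zero_lt_iff.mpr hc₀
  mul_mem' {g h} hg hh i j := by
    have e : (g : Matrix n n K) * (h : Matrix n n K) - 1
        = ((g : Matrix n n K) - 1) * (h : Matrix n n K) + ((h : Matrix n n K) - 1) := by
      noncomm_ring
    change v (((g : Matrix n n K) * (h : Matrix n n K) - 1) i j) < c
    rw [e, Matrix.add_apply]
    refine v.map_add_lt (v.map_mul_apply_lt hc₀ (fun i j k ↦ ?_) i j) (hh i j)
    exact (mul_le_of_le_one_right' (v.map_entry_le_one_of_sub_one_lt hc₁ hh k j)).trans_lt (hg i k)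
  inv_mem' {g} hg i j := by
    have e : (g : Matrix n n K).adjugate - 1
        = -((g : Matrix n n K).adjugate * ((g : Matrix n n K) - 1)) := by
      rw [mul_sub, Matrix.adjugate_mul, g.det_coe]
      simp
    change v (((g : Matrix n n K).adjugate - 1) i j) < c
    rw [e, Matrix.neg_apply, Valuation.map_neg]
    refine v.map_mul_apply_lt hc₀ (fun i j k ↦ ?_) i j
    exact (mul_le_of_le_one_left' (v.map_adjugate_le_one
      (v.map_entry_le_one_of_sub_one_lt hc₁ hg) i k)).trans_lt (hg k j)

variable {v} in
lemma mem_congruenceSubgroup {c : Γ} {hc₀ : c ≠ 0} {hc₁ : c ≤ 1} {g : SpecialLinearGroup n K} :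
    g ∈ v.congruenceSubgroup c hc₀ hc₁ ↔ ∀ i j, v (((g : Matrix n n K) - 1) i j) < c :=
  Iff.rfl

lemma countable_quotient_congruenceSubgroup {D : Set K} (hD : D.Countable)
    (hdense : ∀ z c : K, c ≠ 0 → ∃ d ∈ D, v (z - d) < v c) {c : K} (hc : c ≠ 0)
    (hc₀ : v c ≠ 0) (hc₁ : v c ≤ 1) :
    Countable (SpecialLinearGroup n K ⧸ v.congruenceSubgroup (n := n) (v c) hc₀ hc₁) := by
  have : Countable D := hD.to_subtype
  have hsmall (g : SpecialLinearGroup n K) : ∃ e : D, v e ≠ 0 ∧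
      ∀ i j, v ((g : Matrix n n K).adjugate i j) * v e ≤ v c := by
    let F (o : Option (n × n)) : K := o.elim 1 fun p ↦ (g : Matrix n n K).adjugate p.1 p.2
    obtain ⟨o, -, ho⟩ := Finset.exists_max_image Finset.univ (fun o ↦ v (F o)) ⟨none, by simp⟩
    have ho₀ : v (F o) ≠ 0 := by
      have : (1 : Γ) ≤ v (F o) := by simpa [F] using ho none (Finset.mem_univ _)
      exact (zero_lt_one.trans_le this).ne'
    have hco : c / F o ≠ 0 := div_ne_zero hc (v.ne_zero_iff.mp ho₀)
    obtain ⟨e, heD, he⟩ := hdense _ _ hco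
    have hve : v e = v c / v (F o) := by
      rw [← map_div₀, ← v.map_sub_eq_of_lt_left he, sub_sub_cancel]
    refine ⟨⟨e, heD⟩, hve ▸ div_ne_zero hc₀ ho₀, fun i j ↦ ?_⟩
    calc v ((g : Matrix n n K).adjugate i j) * v e ≤ v (F o) * v e := by
          gcongr
          exact ho (some (i, j)) (Finset.mem_univ _)
      _ = v c := by rw [hve, mul_div_cancel₀ _ ho₀]
  choose e he₀ he using hsmall
  have happrox (g : SpecialLinearGroup n K) (i j : n) : ∃ d : D,
      v ((g : Matrix n n K) i j - d) < v (e g : K) := by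
    obtain ⟨d, hd, h⟩ := hdense ((g : Matrix n n K) i j) (e g) ((v.ne_zero_iff).mp (he₀ g))
    exact ⟨⟨d, hd⟩, h⟩
  choose q hq using happrox
  let f (g : SpecialLinearGroup n K) : D × (n → n → D) := (e g, q g)
  have hf (g h : SpecialLinearGroup n K) (hgh : f g = f h) :
      (g : SpecialLinearGroup n K ⧸ v.congruenceSubgroup (n := n) (v c) hc₀ hc₁) = h := by
    rw [QuotientGroup.eq, mem_congruenceSubgroup]
    have e' : (g : Matrix n n K).adjugate * (h : Matrix n n K) - 1
        = (g : Matrix n n K).adjugate * ((h : Matrix n n K) - g) := by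
      rw [mul_sub, Matrix.adjugate_mul, g.det_coe, one_smul]
    change ∀ i j, v (((g : Matrix n n K).adjugate * (h : Matrix n n K) - 1) i j) < v c
    rw [e']
    refine v.map_mul_apply_lt hc₀ fun i j k ↦ ?_
    by_cases ha : v ((g : Matrix n n K).adjugate i k) = 0
    · simpa [ha] using zero_lt_iff.mpr hc₀
    refine lt_of_lt_of_le ?_ (he g i k)
    refine mul_lt_mul_of_pos_left ?_ (zero_lt_iff.mpr ha)
    have h₁ : e g = e h := congrArg Prod.fst hgh
    have h₂ : q g = q h := congrArg Prod.snd hgh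
    have := v.map_sub_lt (h₁ ▸ hq h k j) (h₂ ▸ hq g k j)
    simpa [h₁] using this
  have : Function.Injective fun x : SpecialLinearGroup n K ⧸
      v.congruenceSubgroup (n := n) (v c) hc₀ hc₁ ↦ f x.out := fun x y hxy ↦ by
    simpa using hf _ _ hxy
  exact this.countable

lemma map_pow_sub_one_sub_nsmul_lt {c : Γ} (hc₀ : c ≠ 0) (hc₁ : c < 1) {Y : Matrix n n K}
    (hY : ∀ i j, v (Y i j) ≤ c) (k : ℕ) (i j : n) :
    v (((1 + Y) ^ k - 1 - k • Y) i j) < c := by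
  induction k generalizing i j with
  | zero => simpa using zero_lt_iff.mpr hc₀
  | succ k ih =>
    have e : (1 + Y) ^ (k + 1) - 1 - (k + 1) • Y
        = ((1 + Y) ^ k - 1 - k • Y) * (1 + Y) + (k • Y) * Y := by
      rw [pow_succ]
      simp only [add_smul, one_smul, sub_mul, mul_add, mul_one, one_mul]
      abel
    have hnat (k : ℕ) : v (k : K) ≤ 1 := by
      induction k with
      | zero => simp
      | succ k ih => simpa using v.map_add_le ih v.map_one.le
    rw [e, Matrix.add_apply]
    refine v.map_add_lt (v.map_mul_apply_lt hc₀ (fun i j l ↦ ?_) i j)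
      (v.map_mul_apply_lt hc₀ (fun i j l ↦ ?_) i j)
    · refine (mul_le_of_le_one_right' ?_).trans_lt (ih i l)
      rw [Matrix.add_apply]
      refine v.map_add_le ?_ ((hY l j).trans hc₁.le)
      rw [Matrix.one_apply]
      split_ifs <;> simp
    · rw [Matrix.smul_apply, nsmul_eq_mul, map_mul]
      calc v (k : K) * v (Y i l) * v (Y l j) ≤ 1 * c * c := by
            gcongr
            exacts [hnat k, hY i l, hY l j]
        _ < c := by
            rw [one_mul]
            exact mul_lt_of_lt_one_right (zero_lt_iff.mpr hc₀) hc₁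

/-- If `v` is trivial on nonzero integers, then a nontrivial element `g` close to the identity
has nontrivial powers lying no closer to the identity than `g`. -/
lemma exists_forall_pow_notMem_congruenceSubgroup (hv : ∀ k : ℕ, k ≠ 0 → v (k : K) = 1)
    {g : SpecialLinearGroup n K} (hg : g ≠ 1)
    (hg₁ : g ∈ v.congruenceSubgroup (n := n) 1 one_ne_zero le_rfl) :
    ∃ (c : K) (_ : c ≠ 0) (hc₀ : v c ≠ 0) (hc₁ : v c ≤ 1), ∀ k : ℕ, k ≠ 0 →
      g ^ k ∉ v.congruenceSubgroup (n := n) (v c) hc₀ hc₁ := by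
  set Y : Matrix n n K := (g : Matrix n n K) - 1 with hYdef
  obtain ⟨i₀, j₀, h₀⟩ : ∃ i j, Y i j ≠ 0 := by
    by_contra! h
    refine hg (Subtype.ext (sub_eq_zero.mp ?_))
    ext i j
    exact h i j
  obtain ⟨⟨i, j⟩, -, hmax⟩ := Finset.exists_max_image Finset.univ
    (fun p : n × n ↦ v (Y p.1 p.2)) ⟨(i₀, j₀), Finset.mem_univ _⟩
  have hY (a b : n) : v (Y a b) ≤ v (Y i j) := hmax (a, b) (Finset.mem_univ _)
  have hc₀ : v (Y i j) ≠ 0 :=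
    ((zero_lt_iff.mpr (v.ne_zero_iff.mpr h₀)).trans_le (hY i₀ j₀)).ne'
  refine ⟨Y i j, v.ne_zero_iff.mp hc₀, hc₀, (hg₁ i j).le, fun k hk hmem ↦ ?_⟩
  have h₁ := v.map_pow_sub_one_sub_nsmul_lt hc₀ (hg₁ i j) hY k i j
  have h₂ : v (((g : Matrix n n K) ^ k - 1) i j) < v (Y i j) :=
    Matrix.SpecialLinearGroup.coe_pow g k ▸ hmem i j
  rw [show (1 : Matrix n n K) + Y = g by simp [hYdef], Matrix.sub_apply _ (k • Y)] at h₁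
  have h₃ := v.map_sub_lt h₂ h₁
  rw [sub_sub_cancel, Matrix.smul_apply, nsmul_eq_mul, map_mul, hv k hk, one_mul] at h₃
  exact h₃.false

theorem exists_countable_quotient_inf_zpowers_eq_bot (hv : ∀ k : ℕ, k ≠ 0 → v (k : K) = 1)
    {D : Set K} (hD : D.Countable) (hdense : ∀ z c : K, c ≠ 0 → ∃ d ∈ D, v (z - d) < v c)
    (γ : SpecialLinearGroup n K) :
    ∃ H : Subgroup (SpecialLinearGroup n K),
      Countable (SpecialLinearGroup n K ⧸ H) ∧ H ⊓ Subgroup.zpowers γ = ⊥ := by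
  suffices ∃ H : Subgroup (SpecialLinearGroup n K), Countable (SpecialLinearGroup n K ⧸ H) ∧
      ∀ k : ℕ, γ ^ k ∈ H → γ ^ k = 1 by
    obtain ⟨H, hH, h⟩ := this
    refine ⟨H, hH, (Subgroup.eq_bot_iff_forall _).mpr ?_⟩
    rintro _ ⟨hx, k, rfl⟩
    obtain ⟨k, rfl | rfl⟩ := k.eq_nat_or_neg
    · simpa using h k (by simpa using hx)
    · simpa using h k (by simpa using hx)
  by_cases hγ : ∃ k : ℕ, γ ^ k ∈ v.congruenceSubgroup (n := n) 1 one_ne_zero le_rfl ∧ γ ^ k ≠ 1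
  · obtain ⟨k, hk, hk₁⟩ := hγ
    obtain ⟨c, hc, hc₀, hc₁, h⟩ := v.exists_forall_pow_notMem_congruenceSubgroup hv hk₁ hk
    refine ⟨_, v.countable_quotient_congruenceSubgroup hD hdense hc hc₀ hc₁, fun l hl ↦ ?_⟩
    by_cases hl₀ : l = 0
    · simp [hl₀]
    · refine absurd (pow_mem hl k) ?_
      rw [← pow_mul, mul_comm, pow_mul]
      exact h l hl₀
  · push Not at hγ
    refine ⟨v.congruenceSubgroup (n := n) (v 1) (by simp) (by simp),
      v.countable_quotient_congruenceSubgroup hD hdense one_ne_zero _ _, fun k hk ↦ hγ k ?_⟩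
    simpa [mem_congruenceSubgroup] using hk

end Matrices

section Roots

open Polynomial

variable {K Γ : Type*} [Field K] [LinearOrderedCommGroupWithZero Γ] (v : Valuation K Γ)

lemma pow_card_le_map_multiset_prod {g : Γ} (s : Multiset K) (hs : ∀ x ∈ s, g ≤ v x) :
    g ^ s.card ≤ v s.prod := by
  induction s using Multiset.induction with
  | empty => simp
  | cons x s ih =>
    rw [Multiset.card_cons, Multiset.prod_cons, map_mul, pow_succ']
    exact mul_le_mul' (hs x (Multiset.mem_cons_self x s))
      (ih fun y hy ↦ hs y (Multiset.mem_cons_of_mem hy))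

/-- Continuity of roots: if the coefficients of `q` are close to those of `p`, then every root of
`p` is close to a root of `q`. -/
lemma exists_mem_roots_map_sub_lt {p q : K[X]} (hq : q.Splits) {d : ℕ} (hpd : p.natDegree = d)
    (hqd : q.natDegree ≤ d) {α c : K} (hα : p.IsRoot α) (hp : p ≠ 0) (hc : c ≠ 0)
    (hlead : v ((p - q).coeff d) < v p.leadingCoeff)
    (hcoeff : ∀ i ≤ d, v ((p - q).coeff i) * v α ^ i < v p.leadingCoeff * v c ^ d) :
    ∃ β ∈ q.roots, v (α - β) < v c := by
  by_contra! h
  have hqlead : v (q.coeff d) = v p.leadingCoeff := by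
    rw [← v.map_sub_eq_of_lt_left hlead, coeff_sub, leadingCoeff, hpd, sub_sub_cancel]
  have hp₀ : v p.leadingCoeff ≠ 0 := v.ne_zero_iff.mpr (leadingCoeff_ne_zero.mpr hp)
  have hqd' : q.natDegree = d :=
    hqd.antisymm (le_natDegree_of_ne_zero (v.ne_zero_iff.mp (hqlead ▸ hp₀)))
  have hlt : v (q.eval α) < v p.leadingCoeff * v c ^ d := by
    have e : q.eval α = -(p - q).eval α := by simp [hα.eq_zero]
    rw [e, Valuation.map_neg, eval_eq_sum_range' (n := d + 1)
      (Nat.lt_succ_of_le ((natDegree_sub_le_of_le hpd.le hqd).trans_eq (max_self d)))]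
    refine v.map_sum_lt (mul_ne_zero hp₀ (pow_ne_zero _ (v.ne_zero_iff.mpr hc))) fun i hi ↦ ?_
    rw [map_mul, map_pow]
    exact hcoeff i (Nat.lt_succ_iff.mp (Finset.mem_range.mp hi))
  refine hlt.not_ge ?_
  rw [hq.eval_eq_prod_roots, map_mul, show q.leadingCoeff = q.coeff d by rw [leadingCoeff, hqd'], hqlead]
  gcongr
  refine le_of_eq_of_le ?_ (v.pow_card_le_map_multiset_prod (g := v c) _ ?_)
  · rw [Multiset.card_map, ← hq.natDegree_eq_card_roots, hqd']
  · intro x hx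
    obtain ⟨β, hβ, rfl⟩ := Multiset.mem_map.mp hx
    exact h β hβ

end Roots

section PowerSeries

open Polynomial

variable {k K Γ : Type*} [Field k] [Field K] [Algebra (PowerSeries k) K]
  [LinearOrderedCommGroupWithZero Γ] {v : Valuation K Γ}

lemma map_algebraMap_eq_one_of_isUnit (hle : ∀ f : PowerSeries k, v (algebraMap _ K f) ≤ 1)
    {f : PowerSeries k} (hf : IsUnit f) : v (algebraMap _ K f) = 1 := by
  obtain ⟨g, hg⟩ := hf.exists_right_inv
  refine (hle f).antisymm ?_
  calc (1 : Γ) = v (algebraMap _ K f) * v (algebraMap _ K g) := by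
        rw [← map_mul, ← map_mul, hg, map_one, map_one]
    _ ≤ v (algebraMap _ K f) := mul_le_of_le_one_right' (hle g)

lemma exists_map_X_pow_lt [FaithfulSMul (PowerSeries k) K] [Algebra.IsAlgebraic (PowerSeries k) K]
    (hle : ∀ f : PowerSeries k, v (algebraMap _ K f) ≤ 1)
    (hX : v (algebraMap _ K (PowerSeries.X : PowerSeries k)) < 1) {e : K} (he : e ≠ 0) :
    ∃ N : ℕ, v (algebraMap _ K (PowerSeries.X : PowerSeries k)) ^ N < v e := by
  rcases lt_or_ge 1 (v e) with h1 | h1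
  · exact ⟨0, by simpa⟩
  obtain ⟨p, hp₀, hp⟩ := (Algebra.IsAlgebraic.isAlgebraic (R := PowerSeries k)
    e).exists_nonzero_coeff_and_aeval_eq_zero (mem_nonZeroDivisors_of_ne_zero he)
  have hpe : v (algebraMap _ K (p.coeff 0)) ≤ v e := by
    rw [← p.divX_mul_X_add, map_add, map_mul, aeval_X, aeval_C, add_eq_zero_iff_neg_eq] at hp
    rw [← hp, Valuation.map_neg, map_mul, aeval_eq_sum_range]
    refine mul_le_of_le_one_left' (v.map_sum_le fun i _ ↦ ?_)
    rw [Algebra.smul_def, map_mul, map_pow]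
    exact mul_le_one' (hle _) (pow_le_one' h1 i)
  obtain ⟨N, u, hu⟩ := IsDiscreteValuationRing.eq_unit_mul_pow_irreducible hp₀
    (PowerSeries.X_irreducible (R := k))
  rw [hu, map_mul, map_mul, map_algebraMap_eq_one_of_isUnit hle u.isUnit, one_mul, map_pow,
    map_pow] at hpe
  have hX₀ : v (algebraMap _ K (PowerSeries.X : PowerSeries k)) ≠ 0 := by
    rw [v.ne_zero_iff]
    simp
  refine ⟨N + 1, lt_of_lt_of_le ?_ hpe⟩
  rw [pow_succ]
  exact mul_lt_of_lt_one_right (zero_lt_iff.mpr (pow_ne_zero _ hX₀)) hX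

lemma exists_countable_dense [Countable k] [IsAlgClosed K] [FaithfulSMul (PowerSeries k) K]
    [Algebra.IsAlgebraic (PowerSeries k) K]
    (hle : ∀ f : PowerSeries k, v (algebraMap _ K f) ≤ 1)
    (hX : v (algebraMap _ K (PowerSeries.X : PowerSeries k)) < 1) :
    ∃ D : Set K, D.Countable ∧ ∀ z c : K, c ≠ 0 → ∃ d ∈ D, v (z - d) < v c := by
  let φ : k[X] →+* K := (algebraMap (PowerSeries k) K).comp Polynomial.coeToPowerSeries.ringHom
  have : Countable k[X] := by
    rw [← Cardinal.mk_le_aleph0_iff]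
    exact Polynomial.cardinalMk_le_max.trans (by simp)
  have : Countable k[X][X] := by
    rw [← Cardinal.mk_le_aleph0_iff]
    exact Polynomial.cardinalMk_le_max.trans (by simp)
  refine ⟨⋃ q : k[X][X], {β | β ∈ (q.map φ).roots},
    Set.countable_iUnion fun q ↦ (Multiset.finite_toSet _).countable, fun α c hc ↦ ?_⟩
  obtain ⟨P, hP₀, hP⟩ := Algebra.IsAlgebraic.isAlgebraic (R := PowerSeries k) α
  set x : Γ := v (algebraMap _ K (PowerSeries.X : PowerSeries k)) with hx
  set p : K[X] := P.map (algebraMap _ K) with hp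
  have hp₀ : p ≠ 0 :=
    (Polynomial.map_ne_zero_iff (FaithfulSMul.algebraMap_injective _ _)).mpr hP₀
  obtain ⟨w, hw₁, hw⟩ : ∃ w : K, 1 ≤ v w ∧ v α ≤ v w := by
    rcases le_total 1 (v α) with h | h
    exacts [⟨α, h, le_rfl⟩, ⟨1, by simp, by simpa using h⟩]
  set d := p.natDegree with hd
  have hw₀ : v w ≠ 0 := (zero_lt_one.trans_le hw₁).ne'
  have hlc₀ : p.leadingCoeff ≠ 0 := leadingCoeff_ne_zero.mpr hp₀
  obtain ⟨N₁, hN₁⟩ := exists_map_X_pow_lt hle hX hlc₀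
  obtain ⟨N₂, hN₂⟩ := exists_map_X_pow_lt hle hX (e := p.leadingCoeff * c ^ d / w ^ d)
    (div_ne_zero (mul_ne_zero hlc₀ (pow_ne_zero _ hc)) (pow_ne_zero _ (v.ne_zero_iff.mp hw₀)))
  rw [← hx] at hN₁ hN₂
  set N := max N₁ N₂
  let q : k[X][X] := ∑ i ∈ Finset.range (d + 1), monomial i ((P.coeff i).trunc N)
  have hqcoeff (i : ℕ) (hi : i ≤ d) : q.coeff i = (P.coeff i).trunc N := by
    simp only [q, finsetSum_coeff, coeff_monomial]
    rw [Finset.sum_ite_eq', if_pos (Finset.mem_range.mpr (Nat.lt_succ_of_le hi))]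
  have hclose (i : ℕ) (hi : i ≤ d) : v ((p - q.map φ).coeff i) ≤ x ^ N := by
    rw [coeff_sub, coeff_map, coeff_map, hqcoeff i hi]
    nth_rw 1 [PowerSeries.eq_X_pow_mul_shift_add_trunc N (P.coeff i)]
    simp only [φ, RingHom.comp_apply, coeToPowerSeries.ringHom_apply, map_add, map_mul,
      add_sub_cancel_right, map_pow]
    exact mul_le_of_le_one_right' (hle _)
  have hqd : (q.map φ).natDegree ≤ d := by
    refine natDegree_map_le.trans (natDegree_sum_le_of_forall_le _ _ fun i hi ↦ ?_)
    exact (natDegree_monomial_le _).trans (Nat.lt_succ_iff.mp (Finset.mem_range.mp hi))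
  obtain ⟨β, hβ, h⟩ := v.exists_mem_roots_map_sub_lt (IsAlgClosed.splits (q.map φ)) hd.symm hqd
    (α := α) (by rw [IsRoot, hp, eval_map_algebraMap, hP]) hp₀ hc
    ((hclose d le_rfl).trans_lt
      ((pow_le_pow_right_of_le_one' hX.le (le_max_left _ _)).trans_lt hN₁))
    fun i hi ↦ by
      calc v ((p - q.map φ).coeff i) * v α ^ i ≤ x ^ N₂ * v w ^ d := by
            refine mul_le_mul' ((hclose i hi).trans
              (pow_le_pow_right_of_le_one' hX.le (le_max_right _ _))) ?_
            exact (pow_le_pow_left₀ zero_le hw i).trans (pow_le_pow_right₀ hw₁ hi)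
        _ < v (p.leadingCoeff * c ^ d / w ^ d) * v w ^ d := by
            gcongr
            exact zero_lt_iff.mpr (pow_ne_zero _ hw₀)
        _ = v p.leadingCoeff * v c ^ d := by
            rw [map_div₀, map_pow, div_mul_cancel₀ _ (pow_ne_zero _ hw₀), map_mul, map_pow]
  exact ⟨β, Set.mem_iUnion.mpr ⟨q, hβ⟩, h⟩

end PowerSeries

end Valuation

section Complex

open Cardinal

instance faithfulSMul_algebraicClosure_fractionRing (R : Type*) [CommRing R] [IsDomain R] :
    FaithfulSMul R (AlgebraicClosure (FractionRing R)) := by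
  rw [faithfulSMul_iff_algebraMap_injective,
    IsScalarTower.algebraMap_eq R (FractionRing R) (AlgebraicClosure (FractionRing R))]
  exact (algebraMap (FractionRing R) _).injective.comp (IsFractionRing.injective R _)

/-- The field `ℂ` is abstractly isomorphic to an algebraic closure of the field of Laurent series
over `ℚ`. -/
lemma nonempty_complex_ringEquiv_algebraicClosure_fractionRing_powerSeries :
    Nonempty (ℂ ≃+* AlgebraicClosure (FractionRing (PowerSeries ℚ))) := by
  let R := PowerSeries ℚ
  let F := FractionRing R
  let K := AlgebraicClosure F
  have hinj := FaithfulSMul.algebraMap_injective R K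
  have : CharZero K :=
    charZero_of_injective_ringHom ((algebraMap R K).comp (algebraMap ℚ R)).injective
  have hR : #R = 𝔠 := by
    change #((Unit →₀ ℕ) → ℚ) = 𝔠
    simp
  have hK : #K = 𝔠 := by
    refine le_antisymm ?_ (hR ▸ mk_le_of_injective hinj)
    refine (Algebra.IsAlgebraic.cardinalMk_le_max F K).trans (max_le ?_ aleph0_le_continuum)
    exact hR ▸ (IsFractionRing.cardinalMk R F).le
  refine IsAlgClosed.ringEquiv_of_equiv_of_charZero ?_ (Cardinal.eq.mp ?_)
  · rw [mk_complex]
    exact aleph0_lt_continuum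
  · rw [mk_complex, hK]

/-- There is a valuation on `ℂ`, trivial on `ℚ`, for which `ℂ` is separable. -/
lemma exists_valuation_complex_countable_dense :
    ∃ (Γ : Type) (_ : LinearOrderedCommGroupWithZero Γ) (v : Valuation ℂ Γ) (D : Set ℂ),
      (∀ k : ℕ, k ≠ 0 → v (k : ℂ) = 1) ∧ D.Countable ∧
        ∀ z c : ℂ, c ≠ 0 → ∃ d ∈ D, v (z - d) < v c := by
  let R := PowerSeries ℚ
  let F := FractionRing R
  let K := AlgebraicClosure F
  obtain ⟨e⟩ := nonempty_complex_ringEquiv_algebraicClosure_fractionRing_powerSeries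
  have : Algebra.IsAlgebraic R K :=
    (IsFractionRing.comap_isAlgebraic_iff (K := F)).mpr inferInstance
  obtain ⟨V, hV, hloc⟩ := IsLocalRing.exists_factor_valuationRing (algebraMap R K)
  have hle (f : R) : V.valuation (algebraMap R K f) ≤ 1 := V.valuation_le_one ⟨_, hV f⟩
  have hX : V.valuation (algebraMap R K PowerSeries.X) < 1 := by
    refine (hle _).lt_of_ne fun h ↦ PowerSeries.X_irreducible (R := ℚ) |>.not_isUnit ?_
    exact hloc.map_nonunit _ ((V.valuation_eq_one_iff ⟨_, hV _⟩).mpr h)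
  obtain ⟨D, hD, hdense⟩ := Valuation.exists_countable_dense hle hX
  refine ⟨_, inferInstance, V.valuation.comap e.toRingHom, e.symm '' D, fun k hk ↦ ?_,
    hD.image _, fun z c hc ↦ ?_⟩
  · have hu : IsUnit (k : R) := by
      rw [PowerSeries.isUnit_iff_constantCoeff, map_natCast]
      exact (Nat.cast_ne_zero.mpr hk).isUnit
    simpa using Valuation.map_algebraMap_eq_one_of_isUnit hle hu
  · obtain ⟨d, hd, h⟩ := hdense (e z) (e c) (by simpa using hc)
    exact ⟨_, ⟨d, hd, rfl⟩, by simpa using h⟩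

end Complex

/-- For any element `γ` of `SL_m(ℂ)` there is a subgroup of countable index in `SL_m(ℂ)`
meeting the cyclic subgroup generated by `γ` trivially. -/
theorem exists_countable_index_subgroup_avoiding_zpowers_SL_complex
    (m : ℕ) (hm : 0 < m) (γ : Matrix.SpecialLinearGroup (Fin m) ℂ) :
    ∃ H : Subgroup (Matrix.SpecialLinearGroup (Fin m) ℂ),
      Countable (Matrix.SpecialLinearGroup (Fin m) ℂ ⧸ H) ∧
      H ⊓ Subgroup.zpowers γ = ⊥ := by
  obtain ⟨Γ, _, v, D, hv, hD, hdense⟩ := exists_valuation_complex_countable_dense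
  exact v.exists_countable_quotient_inf_zpowers_eq_bot hv hD hdense γ
end

section
/- Let m be a positive integer, G any subgroup of GL_m(ℝ), and Γ a polycyclic normal subgroup of G. Then the quotient group G/Γ is countably representable. -/
/-- A group is countably representable if it admits a faithful representation by
permutations of a countable set. -/
def CountablyRepresentable (G : Type*) [Group G] : Prop :=
  ∃ (X : Type) (_ : Countable X) (f : G →* Equiv.Perm X), Function.Injective f

/-- A group is polycyclic if it admits a finite subnormal series with cyclic quotients. -/
def IsPolycyclic (G : Type*) [Group G] : Prop :=
  ∃ (d : ℕ) (s : Fin (d + 1) → Subgroup G),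
    s 0 = ⊥ ∧ s (Fin.last d) = ⊤ ∧
    ∀ i : Fin d, s i.castSucc ≤ s i.succ ∧
      ∃ hn : ((s i.castSucc).subgroupOf (s i.succ)).Normal,
        letI := hn
        IsCyclic (↥(s i.succ) ⧸ (s i.castSucc).subgroupOf (s i.succ))

theorem IsPolycyclic.countable {G : Type*} [Group G] (h : IsPolycyclic G) : Countable G := by
  obtain ⟨d, s, h0, hd, hs⟩ := h
  have key : ∀ i : Fin (d + 1), Countable (s i) := by
    intro i
    induction i using Fin.induction with
    | zero => rw [h0]; infer_instance
    | succ i ih =>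
      obtain ⟨hle, hn, hc⟩ := hs i
      have : Countable (s i.succ ⧸ (s i.castSucc).subgroupOf (s i.succ)) := by
        obtain ⟨g, hg⟩ := hc
        exact Function.Surjective.countable (f := fun n : ℤ => g ^ n) hg
      have : Countable ((s i.castSucc).subgroupOf (s i.succ)) :=
        (Subgroup.subgroupOfEquivOfLe hle).toEquiv.countable_iff.2 ih
      exact (Subgroup.groupEquivQuotientProdSubgroup
        (s := (s i.castSucc).subgroupOf (s i.succ))).countable_iff.2 inferInstance
  have := key (Fin.last d)
  rw [hd] at this
  exact Subgroup.topEquiv.toEquiv.countable_iff.1 this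

theorem countable_quotient_of_isOpen {H : Type*} [Group H] [TopologicalSpace H]
    [ContinuousMul H] [SecondCountableTopology H] (U : Subgroup H) (hU : IsOpen (U : Set H)) :
    Countable (H ⧸ U) := by
  have := QuotientGroup.discreteTopology hU
  have : TopologicalSpace.SeparableSpace (H ⧸ U) :=
    QuotientGroup.mk_surjective.denseRange.separableSpace continuous_quotient_mk'
  exact TopologicalSpace.separableSpace_iff_countable.1 this

/-- If countably many subgroups of countable index intersect in the normal subgroup `N`, then `G ⧸ N`
is countably representable. -/
theorem countablyRepresentable_quotient_of_iInf {G : Type} [Group G] (N : Subgroup G) [N.Normal]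
    (V : ℕ → Subgroup G) (hV : ∀ k, Countable (G ⧸ V k)) (hN : ⨅ k, V k = N) :
    CountablyRepresentable (G ⧸ N) := by
  have hle : ∀ k, N ≤ V k := fun k => hN ▸ iInf_le V k
  have hker : ∀ g, g ∈ N ↔ MulAction.toPermHom G (Σ k, G ⧸ V k) g = 1 := by
    intro g
    constructor
    · intro hg
      ext ⟨k, x⟩ : 1
      obtain ⟨x, rfl⟩ := QuotientGroup.mk_surjective x
      refine congrArg (Sigma.mk k) (QuotientGroup.eq.2 (hle k ?_))
      have := Subgroup.Normal.conj_mem ‹N.Normal› _ (N.inv_mem hg) x⁻¹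
      simpa [mul_assoc] using this
    · intro hg
      rw [← hN, Subgroup.mem_iInf]
      intro k
      have h1 := congrArg (fun e => e (⟨k, ((1 : G) : G ⧸ V k)⟩ : Σ k, G ⧸ V k)) hg
      have h2 : ((g * 1 : G) : G ⧸ V k) = ((1 : G) : G ⧸ V k) :=
        eq_of_heq (Sigma.mk.inj h1).2
      simpa using QuotientGroup.eq.1 h2
  refine ⟨Σ k, G ⧸ V k, inferInstance,
    QuotientGroup.lift N (MulAction.toPermHom G _) fun g hg => (hker g).1 hg, ?_⟩
  rw [injective_iff_map_eq_one]
  intro x hx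
  obtain ⟨g, rfl⟩ := QuotientGroup.mk_surjective x
  exact (QuotientGroup.eq_one_iff g).2 ((hker g).2 hx)

/-- A normal subgroup which is discrete for a filtration by subgroups of countable index has a
countably representable quotient. -/
theorem countablyRepresentable_quotient_of_antitone {G : Type} [Group G] (N : Subgroup G)
    [N.Normal] (U : ℕ → Subgroup G) (hU : ∀ k, Countable (G ⧸ U k)) (hanti : Antitone U)
    (hbot : ⨅ k, U k = ⊥) (hN : U 0 ⊓ N = ⊥) : CountablyRepresentable (G ⧸ N) := by
  refine countablyRepresentable_quotient_of_iInf N (fun k => U k ⊔ N) (fun k => ?_) ?_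
  · refine Function.Surjective.countable
      (f := Subgroup.quotientMapOfLE (le_sup_left : U k ≤ U k ⊔ N)) fun x => ?_
    obtain ⟨g, rfl⟩ := QuotientGroup.mk_surjective x
    exact ⟨g, rfl⟩
  · refine le_antisymm (fun g hg => ?_) (le_iInf fun k => le_sup_right)
    have hg' : ∀ k, ∃ u ∈ U k, ∃ n ∈ N, u * n = g := fun k =>
      Subgroup.mem_sup_of_normal_right.1 (Subgroup.mem_iInf.1 hg k)
    choose u hu n hn hun using hg'
    have heq : ∀ k, u k = u 0 := by
      intro k
      have h1 : (u k)⁻¹ * u 0 = n k * (n 0)⁻¹ := by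
        rw [inv_mul_eq_iff_eq_mul, ← mul_assoc, hun k, ← hun 0, mul_inv_cancel_right]
      have h2 : (u k)⁻¹ * u 0 ∈ U 0 ⊓ N :=
        ⟨(U 0).mul_mem ((U 0).inv_mem (hanti (Nat.zero_le k) (hu k))) (hu 0),
          h1 ▸ N.mul_mem (hn k) (N.inv_mem (hn 0))⟩
      rw [hN, Subgroup.mem_bot, inv_mul_eq_one] at h2
      exact h2
    have h0 : u 0 ∈ ⨅ k, U k := Subgroup.mem_iInf.2 fun k => heq k ▸ hu k
    rw [hbot, Subgroup.mem_bot] at h0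
    rw [← hun 0, h0, one_mul]
    exact hn 0

theorem norm_sub_one_lt_of_mul {n K : Type*} [Fintype n] [DecidableEq n] [NormedField K]
    [IsUltrametricDist K] {ε : ℝ} (hε : 0 < ε) (hε1 : ε ≤ 1) {a b : Matrix n n K}
    (ha : ∀ i j, ‖(a - 1) i j‖ < ε) (hb : ∀ i j, ‖(b - 1) i j‖ < ε) (i j : n) :
    ‖(a * b - 1) i j‖ < ε := by
  have h : a * b - 1 = (a - 1) * (b - 1) + (a - 1) + (b - 1) := by noncomm_ring
  have hmul : ‖((a - 1) * (b - 1)) i j‖ < ε := by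
    rw [Matrix.mul_apply]
    have : Nonempty n := ⟨i⟩
    refine (Finset.univ_nonempty.norm_sum_le_sup'_norm _).trans_lt
      ((Finset.sup'_lt_iff _).2 fun k _ => ?_)
    rw [norm_mul]
    nlinarith [ha i k, hb k j, norm_nonneg ((a - 1) i k), norm_nonneg ((b - 1) k j)]
  rw [h, Matrix.add_apply, Matrix.add_apply]
  exact (IsUltrametricDist.norm_add_le_max _ _).trans_lt
    (max_lt ((IsUltrametricDist.norm_add_le_max _ _).trans_lt (max_lt hmul (ha i j))) (hb i j))

/-- The congruence subgroup of radius `ε` in the general linear group of an ultrametric field. -/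
def congruenceSubgroup (n K : Type*) [Fintype n] [DecidableEq n] [NormedField K]
    [IsUltrametricDist K] (ε : ℝ) (hε : 0 < ε) (hε1 : ε ≤ 1) :
    Subgroup (Matrix.GeneralLinearGroup n K) where
  carrier := {g | (∀ i j, ‖((g : Matrix n n K) - 1) i j‖ < ε) ∧
    ∀ i j, ‖(((g⁻¹ : Matrix.GeneralLinearGroup n K) : Matrix n n K) - 1) i j‖ < ε}
  one_mem' := by simp [hε]
  mul_mem' {a b} ha hb := by
    refine ⟨fun i j => ?_, fun i j => ?_⟩
    · rw [Units.val_mul]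
      exact norm_sub_one_lt_of_mul hε hε1 ha.1 hb.1 i j
    · rw [mul_inv_rev, Units.val_mul]
      exact norm_sub_one_lt_of_mul hε hε1 hb.2 ha.2 i j
  inv_mem' {a} ha := ⟨ha.2, by rw [inv_inv]; exact ha.1⟩

theorem isOpen_congruenceSubgroup (n K : Type*) [Fintype n] [DecidableEq n] [NormedField K]
    [IsUltrametricDist K] (ε : ℝ) (hε : 0 < ε) (hε1 : ε ≤ 1) :
    IsOpen (congruenceSubgroup n K ε hε hε1 : Set (Matrix.GeneralLinearGroup n K)) := by
  have hval : IsOpen {a : Matrix n n K | ∀ i j, ‖(a - 1) i j‖ < ε} := by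
    simp only [Set.ofPred_forall]
    refine isOpen_iInter_of_finite fun i => isOpen_iInter_of_finite fun j => ?_
    exact isOpen_lt ((continuous_id.sub continuous_const).matrix_elem i j).norm continuous_const
  exact (hval.preimage Units.continuous_val).inter (hval.preimage Units.continuous_coe_inv)

theorem secondCountableTopology_generalLinearGroup (n K : Type*) [Fintype n] [DecidableEq n]
    [NormedField K] [SecondCountableTopology K] :
    SecondCountableTopology (Matrix.GeneralLinearGroup n K) := by
  have : SecondCountableTopology (Matrix n n K) :=
    inferInstanceAs (SecondCountableTopology (n → n → K))
  have : SecondCountableTopology (Matrix n n K)ᵐᵒᵖ :=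
    MulOpposite.opHomeomorph.symm.isInducing.secondCountableTopology
  exact Units.isEmbedding_embedProduct.isInducing.secondCountableTopology

/-- The quotient of a linear group over a separable ultrametric field by a normal subgroup that
meets the open unit congruence subgroup trivially is countably representable. -/
theorem countablyRepresentable_quotient_of_linear {n K : Type*} [Fintype n] [DecidableEq n]
    [NormedField K] [IsUltrametricDist K] [SecondCountableTopology K] {G : Type} [Group G]
    (f : G →* Matrix.GeneralLinearGroup n K) (hf : Function.Injective f) (N : Subgroup G)
    [N.Normal]
    (hN : ∀ g ∈ N, (∀ i j, ‖((f g : Matrix n n K) - 1) i j‖ < 1) → g = 1) :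
    CountablyRepresentable (G ⧸ N) := by
  have := secondCountableTopology_generalLinearGroup n K
  let r : ℕ → ℝ := fun k => 1 / ((k : ℝ) + 1)
  have hr0 : ∀ k, 0 < r k := fun k => Nat.one_div_pos_of_nat
  have hr1 : ∀ k, r k ≤ 1 := fun k => by
    simpa [r] using Nat.one_div_le_one_div (α := ℝ) (Nat.zero_le k)
  let U : ℕ → Subgroup G := fun k => (congruenceSubgroup n K (r k) (hr0 k) (hr1 k)).comap f
  refine countablyRepresentable_quotient_of_antitone N U (fun k => ?_) ?_ ?_ ?_
  · have := countable_quotient_of_isOpen _ (isOpen_congruenceSubgroup n K (r k) (hr0 k) (hr1 k))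
    refine Function.Injective.countable (f := Quotient.map' (s₂ := QuotientGroup.leftRel
      (congruenceSubgroup n K (r k) (hr0 k) (hr1 k))) f fun a b h => ?_) ?_
    · rw [QuotientGroup.leftRel_apply] at h ⊢
      simpa [U] using h
    · intro x y
      induction x using QuotientGroup.induction_on with | H x => ?_
      induction y using QuotientGroup.induction_on with | H y => ?_
      intro h
      refine QuotientGroup.eq.2 ?_
      have := QuotientGroup.eq.1 h
      simpa [U] using this
  · intro k l hkl g hg
    have hle : r l ≤ r k := Nat.one_div_le_one_div hkl
    exact ⟨fun i j => (hg.1 i j).trans_le hle, fun i j => (hg.2 i j).trans_le hle⟩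
  · refine (Subgroup.eq_bot_iff_forall _).2 fun g hg => hf ?_
    rw [Subgroup.mem_iInf] at hg
    rw [map_one]
    ext i j : 2
    rw [← sub_eq_zero, ← norm_le_zero_iff]
    exact ge_of_tendsto' tendsto_one_div_add_atTop_nhds_zero_nat fun k => ((hg k).1 i j).le
  · refine (Subgroup.eq_bot_iff_forall _).2 fun g hg => hN g hg.2 fun i j => ?_
    simpa [r] using hg.1.1 i j

/-- Every field extension of `L` embeds in each algebraically closed extension of larger
cardinality, provided that `L` is countable. -/
theorem nonempty_algHom_of_cardinal_le {L E K : Type} [Field L] [Countable L] [Field E]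
    [Algebra L E] [Field K] [Algebra L K] [IsAlgClosed K] (hK : Cardinal.aleph0 < Cardinal.mk K)
    (hEK : Cardinal.mk E ≤ Cardinal.mk K) : Nonempty (E →ₐ[L] K) := by
  obtain ⟨s, hs⟩ := exists_isTranscendenceBasis L E
  obtain ⟨t, ht⟩ := exists_isTranscendenceBasis L K
  have hcard : Cardinal.mk s ≤ Cardinal.mk t := by
    rw [← IsAlgClosed.cardinal_eq_cardinal_transcendence_basis_of_aleph0_lt' _ ht
      Cardinal.mk_le_aleph0 hK]
    exact (Cardinal.mk_set_le s).trans hEK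
  obtain ⟨e⟩ := hcard
  let A := Algebra.adjoin L (Set.range ((↑) : s → E))
  have hw : AlgebraicIndependent L (((↑) : t → K) ∘ e) := ht.1.comp e e.injective
  let φ : A →ₐ[L] K := (MvPolynomial.aeval (((↑) : t → K) ∘ e)).comp
    hs.1.aevalEquiv.symm.toAlgHom
  have hφ : Function.Injective φ := 
    Function.Injective.comp (g := MvPolynomial.aeval (((↑) : t → K) ∘ e)) hw
      hs.1.aevalEquiv.symm.injective
  let : Algebra A K := φ.toRingHom.toAlgebra
  have : IsScalarTower L A K := IsScalarTower.of_algebraMap_eq fun x => (φ.commutes x).symm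
  have : FaithfulSMul A K := (faithfulSMul_iff_algebraMap_injective A K).2 hφ
  have : Algebra.IsAlgebraic A E := hs.isAlgebraic
  exact ⟨(IsAlgClosed.lift (R := A) (S := E) (M := K)).restrictScalars L⟩

theorem pow_card_le_norm_prod_sub {K : Type*} [NormedField K] {ε : ℝ} (hε : 0 ≤ ε) {x : K}
    {s : Multiset K} (h : ∀ y ∈ s, ε ≤ ‖x - y‖) :
    ε ^ Multiset.card s ≤ ‖(s.map fun y => x - y).prod‖ := by
  induction s using Multiset.induction_on with
  | empty => simp
  | cons a s ih =>
    rw [Multiset.card_cons, pow_succ', Multiset.map_cons, Multiset.prod_cons, norm_mul]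
    exact mul_le_mul (h a (Multiset.mem_cons_self a s))
      (ih fun y hy => h y (Multiset.mem_cons_of_mem hy)) (by positivity) (norm_nonneg _)

/-- An algebraically closed algebraic normed extension of a separable normed field is separable. -/
theorem separableSpace_of_isAlgebraic_s4 {R M K : Type*} [CommRing R] [IsDomain R] [Countable R]
    [NormedField M] [Algebra R M] [NormedField K] [NormedAlgebra M K] [Algebra R K]
    [IsScalarTower R M K] [FaithfulSMul R K] [IsAlgClosed K] [Algebra.IsAlgebraic M K]
    (hR : DenseRange (algebraMap R M)) : TopologicalSpace.SeparableSpace K := by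
  refine ⟨{x : K | IsAlgebraic R x}, Algebraic.countable R K, fun x => ?_⟩
  rw [Metric.mem_closure_iff]
  intro ε hε
  have hint : IsIntegral M x := Algebra.IsIntegral.isIntegral x
  let n := (minpoly M x).natDegree
  let F : (Fin n → M) → K := fun c => x ^ n + ∑ i, algebraMap M K (c i) * x ^ (i : ℕ)
  have hF : Continuous F := by
    refine continuous_const.add (continuous_finsetSum _ fun i _ => ?_)
    exact ((continuous_algebraMap M K).comp (continuous_apply i)).mul continuous_const
  have hzero : F (fun i => (minpoly M x).coeff i) = 0 := by
    have h := minpoly.aeval M x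
    rw [Polynomial.aeval_eq_sum_range, Finset.sum_range_succ, Finset.sum_range] at h
    simp only [Algebra.smul_def] at h
    rw [Polynomial.coeff_natDegree, (minpoly.monic hint).leadingCoeff, map_one, one_mul,
      add_comm] at h
    exact h
  have hopen : IsOpen {c | ‖F c‖ < ε ^ n} := isOpen_lt hF.norm continuous_const
  have hdense : DenseRange fun (c : Fin n → R) i => algebraMap R M (c i) :=
    DenseRange.piMap fun _ => hR
  obtain ⟨c, hc⟩ := hdense.exists_mem_open hopen
    ⟨_, show ‖F _‖ < _ by rw [hzero, norm_zero]; positivity⟩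
  let p : Polynomial R := Polynomial.X ^ n + ∑ i : Fin n, Polynomial.C (c i) * Polynomial.X ^ (i : ℕ)
  have hdlt : (∑ i : Fin n, Polynomial.C (c i) * Polynomial.X ^ (i : ℕ)).degree <
      (n : WithBot ℕ) := Polynomial.degree_sum_fin_lt c
  have hp : p.Monic := Polynomial.monic_X_pow_add hdlt
  have hpn : p.natDegree = n := by
    rw [Polynomial.natDegree_add_eq_left_of_degree_lt (by rwa [Polynomial.degree_X_pow]),
      Polynomial.natDegree_X_pow]
  let q := p.map (algebraMap R K)
  have hq : q.Monic := hp.map _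
  have hqsplit : q.Splits := IsAlgClosed.splits q
  have hqx : q.eval x = F fun i => algebraMap R M (c i) := by
    simp [q, p, F, Polynomial.eval_finsetSum, ← IsScalarTower.algebraMap_apply,
      Polynomial.map_sum]
  have hcard : Multiset.card q.roots = n := by
    rw [← hqsplit.natDegree_eq_card_roots, hp.natDegree_map, hpn]
  by_contra! hfar
  refine (show ‖F _‖ < ε ^ n from hc).not_ge ?_
  rw [← hqx, hqsplit.eval_eq_prod_roots_of_monic hq, ← hcard]
  refine pow_card_le_norm_prod_sub hε.le fun y hy => ?_
  rw [← dist_eq_norm]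
  refine hfar y ⟨p, hp.ne_zero, ?_⟩
  rw [← Polynomial.eval_map_algebraMap]
  exact (Polynomial.mem_roots'.1 hy).2

open scoped WithZero in
theorem nonempty_rankOne_of_withZeroMultiplicativeInt {M : Type*} [Field M] (v : Valuation M ℤᵐ⁰)
    [v.IsNontrivial] : Nonempty v.RankOne :=
  Valuation.nonempty_rankOne_iff_mulArchimedean.2 <|
    MulArchimedean.comap (MonoidWithZeroHom.ValueGroup₀.embedding (f := .ofClass v)).toMonoidHom
      MonoidWithZeroHom.ValueGroup₀.embedding_strictMono

universe u in
/-- A complete ultrametric field with a countable dense subring has an algebraically closed separable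
ultrametric extension. -/
theorem exists_isAlgClosed_separable_extension (R : Type*) {M : Type u} [CommRing R] [IsDomain R]
    [Countable R] [NontriviallyNormedField M] [IsUltrametricDist M] [CompleteSpace M] [Algebra R M]
    [FaithfulSMul R M] (hR : DenseRange (algebraMap R M)) :
    ∃ (K : Type u) (_ : NormedField K) (_ : NormedAlgebra M K), IsUltrametricDist K ∧
      SecondCountableTopology K ∧ IsAlgClosed K := by
  let : NormedField (AlgebraicClosure M) := spectralNorm.normedField M (AlgebraicClosure M)
  let : NormedAlgebra M (AlgebraicClosure M) := spectralNorm.normedAlgebra M (AlgebraicClosure M)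
  have : FaithfulSMul R (AlgebraicClosure M) := .trans R M (AlgebraicClosure M)
  have := separableSpace_of_isAlgebraic_s4 (K := AlgebraicClosure M) hR
  exact ⟨AlgebraicClosure M, _, inferInstance,
    IsUltrametricDist.isUltrametricDist_of_isNonarchimedean_norm
      (isNonarchimedean_spectralNorm (K := M) (L := AlgebraicClosure M)),
    UniformSpace.secondCountable_of_separable _, inferInstance⟩

open scoped LaurentSeries Valued RatFunc in
/-- A countable field `L` has an algebraically closed separable ultrametric extension of cardinality
at least the continuum whose norm is trivial on `L`. -/
theorem exists_separable_ultrametric_extension (L : Type) [Field L] [Countable L] :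
    ∃ (K : Type) (_ : NormedField K) (_ : Algebra L K), IsUltrametricDist K ∧
      SecondCountableTopology K ∧ IsAlgClosed K ∧ Cardinal.continuum ≤ Cardinal.mk K ∧
      ∀ a : L, ‖algebraMap L K a‖ < 1 → a = 0 := by
  have : (Valued.v : Valuation L⸨X⸩ (WithZero (Multiplicative ℤ))).IsNontrivial := by
    obtain ⟨x, hx⟩ := LaurentSeries.valuation_surjective L (WithZero.exp 1)
    refine ⟨x, ?_, ?_⟩ <;> rw [hx]
    · exact WithZero.exp_ne_zero
    · rw [← WithZero.exp_zero, Ne, WithZero.exp_inj]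
      exact one_ne_zero
  obtain ⟨hr⟩ := nonempty_rankOne_of_withZeroMultiplicativeInt
    (Valued.v : Valuation L⸨X⸩ (WithZero (Multiplicative ℤ)))
  let : NontriviallyNormedField L⸨X⸩ := Valued.toNontriviallyNormedField _ _
  have hM : ∀ a : L, ‖algebraMap L L⸨X⸩ a‖ < 1 → a = 0 := by
    intro a ha
    have h1 : Valued.v (algebraMap L L⸨X⸩ a) < 1 := Valued.toNormedField.norm_lt_one_iff.1 ha
    have h2 : Valued.v (algebraMap L L⸨X⸩ a) ≤ WithZero.exp (-1) := by
      rwa [← WithZero.lt_mul_exp_iff_le WithZero.exp_ne_zero, ← WithZero.exp_add, neg_add_cancel,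
        WithZero.exp_zero]
    have h3 := (LaurentSeries.valuation_le_iff_coeff_lt_eq_zero L (D := 1)).1 h2 0 one_pos
    rwa [LaurentSeries.algebraMap_apply, HahnSeries.C_apply, HahnSeries.coeff_single_same] at h3
  have hc : Countable L⟮X⟯ := by
    have : Countable (Polynomial L) :=
      Cardinal.mk_le_aleph0_iff.1 (Polynomial.cardinalMk_le_max.trans (by simp))
    refine Function.Surjective.countable (f := fun p : Polynomial L × Polynomial L =>
      algebraMap _ L⟮X⟯ p.1 / algebraMap _ L⟮X⟯ p.2) fun z => ?_
    obtain ⟨x, y, -, h⟩ := IsFractionRing.div_surjective (A := Polynomial L) z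
    exact ⟨(x, y), h⟩
  have hdense : DenseRange (algebraMap L⟮X⟯ L⸨X⸩) := LaurentSeries.coe_range_dense
  have hcard : Cardinal.continuum ≤ Cardinal.mk L⸨X⸩ := by
    rw [← Cardinal.two_power_aleph0, ← Cardinal.mk_nat, ← Cardinal.mk_set]
    classical
    refine Cardinal.mk_le_of_injective (f := fun s : Set ℕ => HahnSeries.ofPowerSeries ℤ L
      (PowerSeries.mk fun n => if n ∈ s then 1 else 0)) fun s t h => ?_
    ext n
    have := congrArg (PowerSeries.coeff n) (HahnSeries.ofPowerSeries_injective h)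
    simp only [PowerSeries.coeff_mk] at this
    by_cases hs : n ∈ s <;> by_cases ht : n ∈ t <;> simp_all
  obtain ⟨K, _, _, hK1, hK2, hK3⟩ := exists_isAlgClosed_separable_extension L⟮X⟯ hdense
  refine ⟨K, inferInstance, ((algebraMap L⸨X⸩ K).comp (algebraMap L L⸨X⸩)).toAlgebra, hK1, hK2, hK3,
    hcard.trans (Cardinal.mk_le_of_injective (algebraMap L⸨X⸩ K).injective), fun a ha => hM a ?_⟩
  rwa [RingHom.algebraMap_toAlgebra, RingHom.comp_apply, norm_algebraMap'] at ha

/-- If `G` is any subgroup of `GL_m(ℝ)` and `Γ` is a polycyclic normal subgroup of `G`,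
then `G/Γ` is countably representable. -/
theorem quotient_by_polycyclic_normal_countably_representable
    (m : ℕ) (hm : 0 < m) (G : Subgroup (Matrix.GeneralLinearGroup (Fin m) ℝ))
    (Γ : Subgroup ↥G) [Γ.Normal] (hΓ : IsPolycyclic Γ) :
    CountablyRepresentable (↥G ⧸ Γ) := by
  have := hΓ.countable
  let s : Set ℝ := Set.range fun p : Γ × Fin m × Fin m =>
    (((p.1 : G) : Matrix.GeneralLinearGroup (Fin m) ℝ) : Matrix (Fin m) (Fin m) ℝ) p.2.1 p.2.2
  let L := Subfield.closure s
  have : Countable L := by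
    have hs : Cardinal.mk s ≤ Cardinal.aleph0 := (Set.countable_range _).le_aleph0
    exact Cardinal.mk_le_aleph0_iff.1
      ((Subfield.cardinalMk_closure_le_max s).trans (max_le hs le_rfl))
  obtain ⟨K, _, _, _, _, _, hK, hL⟩ := exists_separable_ultrametric_extension L
  obtain ⟨φ⟩ := nonempty_algHom_of_cardinal_le (L := L) (E := ℝ) (K := K)
    (Cardinal.aleph0_lt_continuum.trans_le hK) (Cardinal.mk_real.trans_le hK)
  have hmap : Function.Injective (Matrix.GeneralLinearGroup.map (n := Fin m) φ.toRingHom) :=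
    Units.map_injective (Matrix.map_injective φ.injective)
  refine countablyRepresentable_quotient_of_linear
    ((Matrix.GeneralLinearGroup.map φ.toRingHom).comp G.subtype)
    (hmap.comp G.subtype_injective) Γ fun g hg hlt => Subtype.ext ?_
  ext i j : 2
  have hmem : ((g : Matrix.GeneralLinearGroup (Fin m) ℝ) : Matrix (Fin m) (Fin m) ℝ) i j -
      (1 : Matrix (Fin m) (Fin m) ℝ) i j ∈ L := by
    refine L.sub_mem (Subfield.subset_closure ⟨(⟨g, hg⟩, i, j), rfl⟩) ?_
    rw [Matrix.one_apply]
    split_ifs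
    exacts [L.one_mem, L.zero_mem]
  have h0 := hL ⟨_, hmem⟩ <| by
    rw [← φ.commutes]
    convert hlt i j using 2
    have hφ : φ ((1 : Matrix (Fin m) (Fin m) ℝ) i j) = (1 : Matrix (Fin m) (Fin m) K) i j := by
      rw [Matrix.one_apply, Matrix.one_apply, apply_ite φ, map_one, map_zero]
    rw [Matrix.sub_apply, ← hφ]
    exact map_sub φ _ _
  exact sub_eq_zero.1 (congrArg Subtype.val h0)
end

section
/- Let G be a group and S_1, …, S_k subgroups of G such that: (a) for all i ≠ j, every element of S_i commutes with every element of S_j; (b) every element of G can be written as a product s_1 s_2 ⋯ s_k with s_i ∈ S_i; (c) for each i there is a decreasing sequence (S_{i,n})_{n ∈ ℕ} of subgroups of S_i, each of countable index in S_i, with ⋂_n S_{i,n} = {1} and with S_{i,n} ∩ Z(S_i) = {1} for every n, where Z(S_i) is the center of S_i. Then G is countably representable. (This is the group-theoretic content of the statement that a connected semi-simple Lie group with finite center whose simple factors are all countably representable is itself countably representable.) -/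
/-- A group acting faithfully on a countable type, in any universe, is countably representable. -/
theorem CountablyRepresentable.of_injective {G : Type*} [Group G] {Y : Type*} [Countable Y]
    (f : G →* Equiv.Perm Y) (hf : Function.Injective f) : CountablyRepresentable G := by
  obtain ⟨e, he⟩ := exists_injective_nat Y
  let E : Equiv.Perm Y ≃* Equiv.Perm (Set.range e) := (Equiv.ofInjective e he).permCongrHom
  exact ⟨Set.range e, inferInstance, E.toMonoidHom.comp f, E.injective.comp hf⟩

/-- A group with countably many subgroups of countable index that intersect trivially is
countably representable. -/
theorem CountablyRepresentable.of_iInf_eq_bot {G : Type*} [Group G] {ι : Type*} [Countable ι]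
    (H : ι → Subgroup G) (hH : ∀ n, Countable (G ⧸ H n)) (hbot : ⨅ n, H n = ⊥) :
    CountablyRepresentable G := by
  refine .of_injective (Y := Σ n, G ⧸ H n) (MulAction.toPermHom G _) ?_
  rw [injective_iff_map_eq_one]
  intro g hg
  have hmem : g ∈ ⨅ n, H n := by
    rw [Subgroup.mem_iInf]
    intro n
    have h : (⟨n, ((g * 1 : G) : G ⧸ H n)⟩ : Σ n, G ⧸ H n) = ⟨n, ((1 : G) : G ⧸ H n)⟩ :=
      Equiv.congr_fun hg (⟨n, ((1 : G) : G ⧸ H n)⟩ : Σ n, G ⧸ H n)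
    have h' := QuotientGroup.eq.1 (eq_of_heq (Sigma.mk.inj h).2)
    simpa using h'
  rwa [hbot, Subgroup.mem_bot] at hmem

/-- The image of a finite product of countable-index subgroups under a surjective homomorphism
has countable index. -/
theorem countable_quotient_map_pi {ι : Type*} [Finite ι] {A : ι → Type*} [∀ i, Group (A i)]
    {G : Type*} [Group G] (φ : (∀ i, A i) →* G) (hφ : Function.Surjective φ)
    (T : ∀ i, Subgroup (A i)) (hT : ∀ i, Countable (A i ⧸ T i)) :
    Countable (G ⧸ (Subgroup.pi Set.univ T).map φ) := by
  refine Function.Surjective.countable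
    (f := fun q : ∀ i, A i ⧸ T i => (φ (fun i => (q i).out) : G ⧸ (Subgroup.pi Set.univ T).map φ)) ?_
  intro q
  obtain ⟨g, rfl⟩ := QuotientGroup.mk_surjective q
  obtain ⟨s, rfl⟩ := hφ g
  refine ⟨fun i => (s i : A i ⧸ T i), QuotientGroup.eq.2 ?_⟩
  rw [← map_inv, ← map_mul]
  refine Subgroup.mem_map_of_mem _ fun i _ => ?_
  exact QuotientGroup.eq.1 (QuotientGroup.out_eq' (s i : A i ⧸ T i))

/-- If a homomorphism from a product is injective on each factor, its kernel is central. -/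
theorem apply_mem_center_of_map_eq_one {ι : Type*} [DecidableEq ι] {A : ι → Type*}
    [∀ i, Group (A i)] {G : Type*} [Group G] (φ : (∀ i, A i) →* G)
    (hφ : ∀ i, Function.Injective fun x : A i => φ (Pi.mulSingle i x))
    {s : ∀ i, A i} (hs : φ s = 1) (i : ι) : s i ∈ Subgroup.center (A i) := by
  rw [Subgroup.mem_center_iff]
  intro x
  have key : Pi.mulSingle i (x * s i * x⁻¹ * (s i)⁻¹) =
      Pi.mulSingle i x * s * (Pi.mulSingle i x)⁻¹ * s⁻¹ := by
    ext j
    rcases eq_or_ne j i with rfl | hj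
    · simp
    · simp [Pi.mulSingle_eq_of_ne hj]
  have h : x * s i * x⁻¹ * (s i)⁻¹ = 1 := hφ i (by simp [key, hs])
  rwa [mul_inv_eq_one, mul_inv_eq_iff_eq_mul] at h

/-- For decreasing chains of subgroups of the factors that meet the centers trivially and
intersect trivially, the images of their products also intersect trivially. -/
theorem iInf_map_pi_eq_bot {ι : Type*} [DecidableEq ι] {A : ι → Type*}
    [∀ i, Group (A i)] {G : Type*} [Group G] (φ : (∀ i, A i) →* G)
    (hφ : ∀ i, Function.Injective fun x : A i => φ (Pi.mulSingle i x))
    (T : ∀ i, ℕ → Subgroup (A i)) (hanti : ∀ i, Antitone (T i)) (hbot : ∀ i, ⨅ n, T i n = ⊥)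
    (hcenter : ∀ i n, T i n ⊓ Subgroup.center (A i) = ⊥) :
    ⨅ n, (Subgroup.pi Set.univ fun i => T i n).map φ = ⊥ := by
  rw [eq_bot_iff]
  intro g hg
  rw [Subgroup.mem_iInf] at hg
  choose t ht htg using hg
  have hconst : ∀ n i, t n i = t 0 i := by
    intro n i
    have hc : (t n * (t 0)⁻¹) i ∈ Subgroup.center (A i) :=
      apply_mem_center_of_map_eq_one φ hφ (by simp [htg]) i
    have hT : (t n * (t 0)⁻¹) i ∈ T i 0 :=
      mul_mem (hanti i (Nat.zero_le n) (ht n i trivial)) (inv_mem (ht 0 i trivial))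
    have h : (t n * (t 0)⁻¹) i ∈ T i 0 ⊓ Subgroup.center (A i) := ⟨hT, hc⟩
    rw [hcenter, Subgroup.mem_bot] at h
    exact mul_inv_eq_one.1 h
  have hone : t 0 = 1 := by
    ext i
    have h : t 0 i ∈ ⨅ n, T i n :=
      Subgroup.mem_iInf.2 fun n => hconst n i ▸ ht n i trivial
    rwa [hbot, Subgroup.mem_bot] at h
  rw [Subgroup.mem_bot, ← htg 0, hone, map_one]

/-- If `G` is generated by pairwise commuting subgroups `S 1, …, S k`, each of which
admits a decreasing sequence of countable-index subgroups with trivial intersection,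
each meeting the center trivially, then `G` is countably representable. -/
theorem countablyRepresentable_of_commuting_factors
    {G : Type*} [Group G] (k : ℕ) (S : Fin k → Subgroup G)
    (hcomm : ∀ i j, i ≠ j → ∀ x ∈ S i, ∀ y ∈ S j, Commute x y)
    (hgen : ∀ g : G, ∃ s : Fin k → G, (∀ i, s i ∈ S i) ∧ g = (List.ofFn s).prod)
    (hchain : ∀ i, ∃ T : ℕ → Subgroup ↥(S i),
      (∀ n, T (n + 1) ≤ T n) ∧
      (∀ n, Countable (↥(S i) ⧸ T n)) ∧
      (⨅ n, T n) = ⊥ ∧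
      ∀ n, T n ⊓ Subgroup.center ↥(S i) = ⊥) :
    CountablyRepresentable G := by
  have hpair : Pairwise fun i j => ∀ x y : G, x ∈ S i → y ∈ S j → Commute x y :=
    fun i j hij x y hx hy => hcomm i j hij x hx y hy
  let φ : (∀ i, S i) →* G := Subgroup.noncommPiCoprod hpair
  have hsurj : Function.Surjective φ := by
    rw [← MonoidHom.range_eq_top, Subgroup.noncommPiCoprod_range, eq_top_iff]
    intro g _
    obtain ⟨s, hs, rfl⟩ := hgen g
    refine Subgroup.list_prod_mem _ fun x hx => ?_
    obtain ⟨i, rfl⟩ := (List.mem_ofFn' s x).1 hx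
    exact Subgroup.mem_iSup_of_mem i (hs i)
  have hinj : ∀ i, Function.Injective fun x : S i => φ (Pi.mulSingle i x) := by
    intro i x y h
    simpa [φ] using h
  choose T hle hcount hbot hcenter using hchain
  exact .of_iInf_eq_bot (fun n => (Subgroup.pi Set.univ fun i => T i n).map φ)
    (fun n => countable_quotient_map_pi φ hsurj _ fun i => hcount i n)
    (iInf_map_pi_eq_bot φ hinj T (fun i => antitone_nat_of_succ_le (hle i)) hbot hcenter)
end
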